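/- Let d ≥ 2. For every 2×2 integer matrix F with det F ≡ 1 (mod d̄) and every χ ∈ ℤ², there exists a d×d unitary matrix U such that U D_p U† = ω^{⟨χ, Fp⟩} D_{Fp} for all p ∈ ℤ². In particular every such pair (F,χ) is realized by an element of the Clifford group C(d), the normalizer of the generalized Pauli group W(d) in the unitary group. -/

import Mathlib

noncomputable section
open Matrix Complex

/-- `d̄ = d` for odd `d`, `2d` for even `d`. -/
def dbar (d : ℕ) : ℕ := if d % 2 = 1 then d else 2 * d

/-- `ω = exp(2πi/d)`. -/
def omega (d : ℕ) : ℂ := Complex.exp (2 * Real.pi * Complex.I / d)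

/-- `τ = −exp(πi/d)`. -/
def tau (d : ℕ) : ℂ := -Complex.exp (Real.pi * Complex.I / d)

/-- The diagonal matrix `T e_r = ω^r e_r`. -/
def Tmat (d : ℕ) : Matrix (Fin d) (Fin d) ℂ :=
  Matrix.diagonal fun r => omega d ^ (r : ℕ)

/-- The cyclic shift `S e_r = e_{r+1 mod d}`. -/
def Smat (d : ℕ) : Matrix (Fin d) (Fin d) ℂ :=
  Matrix.of fun r s => if (r : ℕ) = ((s : ℕ) + 1) % d then 1 else 0

/-- The displacement operators `D_p = τ^{p₁p₂} S^{p₁} T^{p₂}`. -/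
def Dmat (d : ℕ) (p : ℤ × ℤ) : Matrix (Fin d) (Fin d) ℂ :=
  tau d ^ (p.1 * p.2) • (Smat d ^ p.1 * Tmat d ^ p.2)

/-- The symplectic form `⟨p,q⟩ = p₂q₁ − p₁q₂`. -/
def symp (p q : ℤ × ℤ) : ℤ := p.2 * q.1 - p.1 * q.2

/-- Action of a 2×2 integer matrix on `ℤ²`. -/
def Fapp (F : Matrix (Fin 2) (Fin 2) ℤ) (p : ℤ × ℤ) : ℤ × ℤ :=
  (F 0 0 * p.1 + F 0 1 * p.2, F 1 0 * p.1 + F 1 1 * p.2)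

/-- The generalized Pauli group `W(d) = {e^{iξ} D_p}`, as a set of matrices. -/
def Wset (d : ℕ) : Set (Matrix (Fin d) (Fin d) ℂ) :=
  {M | ∃ ξ : ℝ, ∃ p : ℤ × ℤ, M = Complex.exp (ξ * Complex.I) • Dmat d p}

section Heisenberg

variable {G : Type*} [Group G]

/-- If `b` commutes with `a` up to a factor `z` commuting with both, then it commutes with `a ^ n` up
to `z ^ n`. -/
theorem mul_zpow_eq_of_mul_eq {a b z : G} (hza : Commute z a) (h : b * a = z * a * b) (n : ℤ) :
    b * a ^ n = z ^ n * a ^ n * b := by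
  have h1 : b * a * b⁻¹ = z * a := by rw [h]; group
  have h2 : (b * a * b⁻¹) ^ n = z ^ n * a ^ n := by rw [h1, hza.mul_zpow]
  rw [conj_zpow] at h2
  rw [← h2]; group

/-- The Heisenberg commutation rule for integer powers. -/
theorem zpow_mul_zpow_of_mul_eq {c s t : G} (hc : ∀ g, Commute c g)
    (hts : t * s = c ^ (2 : ℤ) * s * t) (m n : ℤ) : t ^ m * s ^ n = c ^ (2 * m * n) * s ^ n * t ^ m := by
  have h1 := mul_zpow_eq_of_mul_eq ((hc s).zpow_left 2) hts n
  rw [← _root_.zpow_mul] at h1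
  have h2 : s ^ n * t = c ^ (-(2 * n)) * t * s ^ n := by
    rw [mul_assoc, h1]; group
  have h3 := mul_zpow_eq_of_mul_eq ((hc t).zpow_left (-(2 * n))) h2 m
  rw [mul_assoc, h3, ← _root_.zpow_mul, ← mul_assoc, ← mul_assoc, ← _root_.zpow_add]
  rw [show 2 * m * n + -(2 * n) * m = 0 by ring, zpow_zero, one_mul]

/-- The displacement elements `c ^ (p₁ p₂) s ^ p₁ t ^ p₂` of a group. -/
def heis (c s t : G) (p : ℤ × ℤ) : G := c ^ (p.1 * p.2) * (s ^ p.1 * t ^ p.2)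

theorem heis_mul {c s t : G} (hc : ∀ g, Commute c g) (hts : t * s = c ^ (2 : ℤ) * s * t)
    (p q : ℤ × ℤ) : heis c s t p * heis c s t q = c ^ symp p q * heis c s t (p + q) := by
  have h := zpow_mul_zpow_of_mul_eq hc hts p.2 q.1
  calc heis c s t p * heis c s t q
      = c ^ (p.1 * p.2) * (s ^ p.1 * t ^ p.2 * c ^ (q.1 * q.2)) * (s ^ q.1 * t ^ q.2) := by
        simp only [heis, mul_assoc]
    _ = c ^ (p.1 * p.2) * c ^ (q.1 * q.2) * s ^ p.1 * (t ^ p.2 * s ^ q.1) * t ^ q.2 := by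
        rw [← ((hc (s ^ p.1 * t ^ p.2)).zpow_left _).eq]; simp only [mul_assoc]
    _ = c ^ (p.1 * p.2) * c ^ (q.1 * q.2) * (s ^ p.1 * c ^ (2 * p.2 * q.1)) * s ^ q.1 * t ^ p.2
          * t ^ q.2 := by
        rw [h]; simp only [mul_assoc]
    _ = c ^ (p.1 * p.2) * c ^ (q.1 * q.2) * c ^ (2 * p.2 * q.1) * (s ^ p.1 * s ^ q.1)
          * (t ^ p.2 * t ^ q.2) := by
        rw [← ((hc (s ^ p.1)).zpow_left _).eq]; simp only [mul_assoc]
    _ = c ^ symp p q * heis c s t (p + q) := by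
        simp only [heis, symp, Prod.fst_add, Prod.snd_add, ← _root_.zpow_add, ← mul_assoc]
        congr 3
        ring

theorem heis_zpow {c s t : G} (hc : ∀ g, Commute c g) (hts : t * s = c ^ (2 : ℤ) * s * t)
    (p : ℤ × ℤ) (n : ℤ) : heis c s t p ^ n = heis c s t (n • p) := by
  have hadd (m n : ℤ) : heis c s t ((m + n) • p) = heis c s t (m • p) * heis c s t (n • p) := by
    rw [heis_mul hc hts, add_smul, show symp (m • p) (n • p) = 0 by simp [symp]; ring, zpow_zero,
      one_mul]
  let f : Multiplicative ℤ →* G := MonoidHom.mk' (fun m => heis c s t (m.toAdd • p))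
    fun m n => hadd m.toAdd n.toAdd
  have h := map_zpow f (Multiplicative.ofAdd 1) n
  simpa [f] using h.symm

theorem heis_zpow_natCast_eq_one {c s t : G} {d : ℕ} (hc : ∀ g, Commute c g)
    (hts : t * s = c ^ (2 : ℤ) * s * t) (hs : s ^ d = 1) (ht : t ^ d = 1) (hcd : c ^ (d * d) = 1)
    (p : ℤ × ℤ) : heis c s t p ^ (d : ℤ) = 1 := by
  rw [heis_zpow hc hts]
  simp only [heis, Prod.smul_fst, Prod.smul_snd, smul_eq_mul]
  rw [show (d * p.1 * (d * p.2) : ℤ) = ((d * d : ℕ) : ℤ) * (p.1 * p.2) by push_cast; ring]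
  simp only [_root_.zpow_mul, zpow_natCast, hs, ht, hcd, _root_.one_zpow, mul_one]

/-- An element intertwining `s`, `t` with the images of the two generators under the pair `(F, χ)`
conjugates every displacement element as prescribed. -/
theorem conj_heis {c s t U : G} {F : Matrix (Fin 2) (Fin 2) ℤ} {χ : ℤ × ℤ} (hc : ∀ g, Commute c g)
    (hts : t * s = c ^ (2 : ℤ) * s * t) (hF : c ^ (F.det - 1) = 1)
    (hs : U * s * U⁻¹ = c ^ (2 * symp χ (F 0 0, F 1 0)) * heis c s t (F 0 0, F 1 0))
    (ht : U * t * U⁻¹ = c ^ (2 * symp χ (F 0 1, F 1 1)) * heis c s t (F 0 1, F 1 1))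
    (p : ℤ × ℤ) :
    U * heis c s t p * U⁻¹ = c ^ (2 * symp χ (Fapp F p)) * heis c s t (Fapp F p) := by
  have hcU (n : ℤ) : U * c ^ n * U⁻¹ = c ^ n := by
    rw [← ((hc U).zpow_left n).eq]; group
  have hsplit : U * heis c s t p * U⁻¹
      = U * c ^ (p.1 * p.2) * U⁻¹ * ((U * s * U⁻¹) ^ p.1 * (U * t * U⁻¹) ^ p.2) := by
    simp only [conj_zpow, heis]; group
  have hsum : p.1 • (F 0 0, F 1 0) + p.2 • (F 0 1, F 1 1) = Fapp F p := by
    ext <;> simp [Fapp] <;> ring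
  rw [hsplit, hcU, hs, ht, ((hc _).zpow_left _).mul_zpow, ((hc _).zpow_left _).mul_zpow,
    heis_zpow hc hts, heis_zpow hc hts, ← _root_.zpow_mul, ← _root_.zpow_mul]
  set a := heis c s t (p.1 • (F 0 0, F 1 0)) with ha
  set b := heis c s t (p.2 • (F 0 1, F 1 1)) with hb
  have hab : a * b = c ^ (p.1 * p.2 * (-F.det)) * heis c s t (Fapp F p) := by
    rw [ha, hb, heis_mul hc hts, hsum]
    congr 2
    simp [symp, Matrix.det_fin_two]; ring
  have hre (i j k : ℤ) : c ^ i * (c ^ j * a * (c ^ k * b)) = c ^ (i + j + k) * (a * b) := by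
    rw [_root_.zpow_add, _root_.zpow_add, mul_assoc (c ^ j), ← mul_assoc a, ← ((hc a).zpow_left k).eq]
    simp only [mul_assoc]
  rw [hre, hab, ← mul_assoc, ← _root_.zpow_add]
  congr 1
  have hone : c ^ ((F.det - 1) * (-(p.1 * p.2))) = 1 := by rw [_root_.zpow_mul, hF, _root_.one_zpow]
  rw [← mul_one (c ^ (2 * symp χ (Fapp F p))), ← hone, ← _root_.zpow_add]
  congr 1
  simp [symp, Fapp]; ring

end Heisenberg

theorem tau_sq (d : ℕ) : tau d ^ 2 = omega d := by
  rw [tau, omega, neg_sq, ← Complex.exp_nat_mul]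
  congr 1
  push_cast; ring

theorem tau_pow_self {d : ℕ} (hd : d ≠ 0) : tau d ^ d = (-1) ^ (d + 1) := by
  have : (d : ℂ) ≠ 0 := by exact_mod_cast hd
  rw [tau, neg_pow, ← Complex.exp_nat_mul, mul_div_cancel₀ _ this, Complex.exp_pi_mul_I, pow_succ]

theorem tau_pow_dbar {d : ℕ} (hd : d ≠ 0) : tau d ^ dbar d = 1 := by
  unfold dbar
  split_ifs with h
  · rw [tau_pow_self hd, Even.neg_one_pow (by rw [Nat.even_iff]; omega)]
  · rw [mul_comm, pow_mul, tau_pow_self hd, ← pow_mul, mul_comm, pow_mul, neg_one_sq, one_pow]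

theorem dvd_dbar (d : ℕ) : d ∣ dbar d := by
  unfold dbar; split_ifs <;> simp

theorem dbar_dvd_two_mul (d : ℕ) : dbar d ∣ 2 * d := by
  unfold dbar; split_ifs <;> simp

theorem dbar_dvd_mul_self (d : ℕ) : dbar d ∣ d * d := by
  unfold dbar
  split_ifs with h
  · simp
  · exact Nat.mul_dvd_mul_right (by omega) d

theorem omega_isPrimitiveRoot {d : ℕ} (hd : d ≠ 0) : IsPrimitiveRoot (omega d) d :=
  Complex.isPrimitiveRoot_exp d hd

theorem norm_tau (d : ℕ) : ‖tau d‖ = 1 := by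
  rw [tau, norm_neg, show (Real.pi * Complex.I / d : ℂ) = ((Real.pi / d : ℝ) : ℂ) * Complex.I by
    push_cast; ring, Complex.norm_exp_ofReal_mul_I]

theorem norm_omega (d : ℕ) : ‖omega d‖ = 1 := by
  rw [← tau_sq, norm_pow, norm_tau, one_pow]

theorem smul_one_mem_unitaryGroup {n : Type*} [Fintype n] [DecidableEq n] {z : ℂ} (hz : ‖z‖ = 1) :
    z • (1 : Matrix n n ℂ) ∈ Matrix.unitaryGroup n ℂ := by
  have h : z * star z = 1 := by
    rw [Complex.star_def, Complex.mul_conj, Complex.normSq_eq_norm_sq, hz]; simp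
  rw [Matrix.mem_unitaryGroup_iff, star_smul, star_one, smul_mul_smul_comm, h, one_smul, one_mul]

theorem Tmat_mem_unitaryGroup (d : ℕ) : Tmat d ∈ Matrix.unitaryGroup (Fin d) ℂ := by
  rw [Matrix.mem_unitaryGroup_iff, Tmat, Matrix.star_eq_conjTranspose,
    Matrix.diagonal_conjTranspose, Matrix.diagonal_mul_diagonal, ← Matrix.diagonal_one]
  congr 1
  ext r
  rw [Pi.star_apply, Complex.star_def, Complex.mul_conj, Complex.normSq_eq_norm_sq, norm_pow,
    norm_omega]
  simp

theorem mul_Smat_apply {d : ℕ} (hd : d ≠ 0) (M : Matrix (Fin d) (Fin d) ℂ) (i r : Fin d) :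
    (M * Smat d) i r = M i ⟨((r : ℕ) + 1) % d, Nat.mod_lt _ (Nat.pos_of_ne_zero hd)⟩ := by
  rw [Matrix.mul_apply,
    Finset.sum_eq_single ⟨((r : ℕ) + 1) % d, Nat.mod_lt _ (Nat.pos_of_ne_zero hd)⟩]
  · simp [Smat]
  · intro k _ hk
    have : (k : ℕ) ≠ ((r : ℕ) + 1) % d := fun h => hk (Fin.ext h)
    simp [Smat, this]
  · simp

theorem Smat_mem_unitaryGroup {d : ℕ} (hd : d ≠ 0) : Smat d ∈ Matrix.unitaryGroup (Fin d) ℂ := by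
  rw [Matrix.mem_unitaryGroup_iff']
  ext i j
  rw [mul_Smat_apply hd, Matrix.star_eq_conjTranspose, Matrix.conjTranspose_apply, Matrix.one_apply]
  have hij : (((j : ℕ) + 1) % d = ((i : ℕ) + 1) % d) ↔ i = j := by
    constructor
    · intro h
      have h' : (j : ℕ) ≡ i [MOD d] := Nat.ModEq.add_right_cancel' 1 h
      exact Fin.ext (Nat.ModEq.eq_of_lt_of_lt h' j.2 i.2).symm
    · rintro rfl; rfl
  simp only [Smat, Matrix.of_apply, hij]
  split_ifs <;> simp

theorem Smat_pow_apply {d : ℕ} (hd : d ≠ 0) (n : ℕ) (i r : Fin d) :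
    (Smat d ^ n) i r = if (i : ℕ) = ((r : ℕ) + n) % d then 1 else 0 := by
  induction n generalizing r with
  | zero => simp [Matrix.one_apply, Nat.mod_eq_of_lt r.2, Fin.ext_iff]
  | succ n ih =>
    rw [pow_succ, mul_Smat_apply hd, ih]
    simp [add_assoc, add_comm 1 n]

theorem Smat_pow_self {d : ℕ} (hd : d ≠ 0) : Smat d ^ d = 1 := by
  ext i r
  simp [Smat_pow_apply hd, Matrix.one_apply, Nat.mod_eq_of_lt r.2, Fin.ext_iff]

theorem Tmat_pow_self {d : ℕ} (hd : d ≠ 0) : Tmat d ^ d = 1 := by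
  rw [Tmat, Matrix.diagonal_pow, ← Matrix.diagonal_one]
  congr 1
  ext r
  rw [Pi.pow_apply, ← pow_mul, mul_comm, pow_mul, (omega_isPrimitiveRoot hd).pow_eq_one, one_pow]

theorem Tmat_mul_Smat {d : ℕ} (hd : d ≠ 0) : Tmat d * Smat d = omega d • (Smat d * Tmat d) := by
  ext i r
  rw [Tmat, Matrix.smul_apply, Matrix.mul_diagonal, Matrix.diagonal_mul, Smat, Matrix.of_apply]
  split_ifs with h
  · rw [h, ← pow_eq_pow_mod _ (omega_isPrimitiveRoot hd).pow_eq_one, pow_succ, smul_eq_mul]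
    ring
  · simp

theorem star_mulVec_dotProduct_mulVec {n : Type*} [Fintype n] [DecidableEq n]
    (A : Matrix.unitaryGroup n ℂ) (x y : n → ℂ) :
    star (A.1 *ᵥ x) ⬝ᵥ (A.1 *ᵥ y) = star x ⬝ᵥ y := by
  rw [Matrix.star_mulVec, Matrix.dotProduct_mulVec, Matrix.vecMul_vecMul,
    ← Matrix.star_eq_conjTranspose, Matrix.mem_unitaryGroup_iff'.mp A.2, Matrix.vecMul_one]

theorem mulVec_pow_mulVec {n : Type*} [Fintype n] [DecidableEq n] {A B : Matrix n n ℂ} {z μ : ℂ}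
    {v : n → ℂ} (hBA : B * A = z • (A * B)) (hv : B *ᵥ v = μ • v) (k : ℕ) :
    B *ᵥ (A ^ k *ᵥ v) = (z ^ k * μ) • (A ^ k *ᵥ v) := by
  induction k with
  | zero => simp [hv]
  | succ k ih =>
    rw [pow_succ', ← Matrix.mulVec_mulVec, Matrix.mulVec_mulVec, hBA, Matrix.smul_mulVec,
      ← Matrix.mulVec_mulVec, ih, Matrix.mulVec_smul, smul_smul, pow_succ']
    congr 1; ring

theorem exists_unit_fixed_vector {d : ℕ} (hd : d ≠ 0) (A B : Matrix.unitaryGroup (Fin d) ℂ)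
    (hB : B ^ d = 1) (hBA : B.1 * A.1 = omega d • (A.1 * B.1)) :
    ∃ v : Fin d → ℂ, B.1 *ᵥ v = v ∧ star v ⬝ᵥ v = 1 := by
  have : Nonempty (Fin d) := ⟨⟨0, Nat.pos_of_ne_zero hd⟩⟩
  have : NeZero d := ⟨hd⟩
  have hB' : B.1 ^ d = 1 := by simpa using congrArg Subtype.val hB
  obtain ⟨μ, hμ⟩ := Module.End.exists_eigenvalue (Matrix.toLin' B.1)
  obtain ⟨w, hw⟩ := hμ.exists_hasEigenvector
  have hBw : B.1 *ᵥ w = μ • w := by simpa using hw.apply_eq_smul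
  have hμd : μ ^ d = 1 := by
    have h (k : ℕ) : B.1 ^ k *ᵥ w = μ ^ k • w := by
      induction k with
      | zero => simp
      | succ k ih =>
        rw [pow_succ', ← Matrix.mulVec_mulVec, ih, Matrix.mulVec_smul, hBw, smul_smul, pow_succ]
    have h1 := h d
    rw [hB', Matrix.one_mulVec] at h1
    have h2 : (μ ^ d - 1) • w = 0 := by rw [sub_smul, one_smul, ← h1, sub_self]
    exact sub_eq_zero.mp ((smul_eq_zero.mp h2).resolve_right hw.2)
  have hω := omega_isPrimitiveRoot hd
  obtain ⟨k, hk, rfl⟩ := hω.eq_pow_of_pow_eq_one hμd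
  set x := A.1 ^ (d - k) *ᵥ w with hx
  have hBx : B.1 *ᵥ x = x := by
    rw [hx, mulVec_pow_mulVec hBA hBw, ← pow_add, Nat.sub_add_cancel hk.le, hω.pow_eq_one, one_smul]
  have hxx : star x ⬝ᵥ x = star w ⬝ᵥ w := star_mulVec_dotProduct_mulVec (A ^ (d - k)) w w
  open scoped ComplexOrder in
  have hpos : 0 < star w ⬝ᵥ w := Matrix.dotProduct_star_self_pos_iff.mpr hw.2
  obtain ⟨r, hr, hrw⟩ : ∃ r : ℝ, 0 < r ∧ star w ⬝ᵥ w = r := by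
    have hpos := Complex.pos_iff.mp hpos
    exact ⟨(star w ⬝ᵥ w).re, hpos.1, Complex.ext rfl (by simpa using hpos.2.symm)⟩
  refine ⟨((√r)⁻¹ : ℂ) • x, by rw [Matrix.mulVec_smul, hBx], ?_⟩
  have hsq : ((√r : ℝ) : ℂ) * (√r : ℝ) = r := by
    rw [← Complex.ofReal_mul, Real.mul_self_sqrt hr.le]
  have hr0 : (r : ℂ) ≠ 0 := by exact_mod_cast hr.ne'
  rw [star_smul, smul_dotProduct, dotProduct_smul, hxx, hrw]
  simp only [smul_eq_mul, star_inv₀, Complex.star_def, Complex.conj_ofReal]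
  rw [← mul_assoc, ← mul_inv, hsq, inv_mul_cancel₀ hr0]

/-- A pair of unitaries satisfying the Weyl relations is unitarily equivalent to `(S, T)`. -/
theorem exists_intertwiner {d : ℕ} (hd : d ≠ 0) (A B : Matrix.unitaryGroup (Fin d) ℂ)
    (hA : A ^ d = 1) (hB : B ^ d = 1) (hBA : B.1 * A.1 = omega d • (A.1 * B.1)) :
    ∃ U ∈ Matrix.unitaryGroup (Fin d) ℂ, U * Smat d = A.1 * U ∧ U * Tmat d = B.1 * U := by
  obtain ⟨v, hBv, hv⟩ := exists_unit_fixed_vector hd A B hB hBA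
  have hA' : A.1 ^ d = 1 := by simpa using congrArg Subtype.val hA
  have hω := omega_isPrimitiveRoot hd
  have hBA_v (k : ℕ) : B.1 *ᵥ (A.1 ^ k *ᵥ v) = omega d ^ k • (A.1 ^ k *ᵥ v) := by
    simpa using mulVec_pow_mulVec (μ := 1) hBA (by simpa using hBv) k
  refine ⟨Matrix.of fun i r => (A.1 ^ (r : ℕ) *ᵥ v) i, ?_, ?_, ?_⟩
  · rw [Matrix.mem_unitaryGroup_iff']
    ext i j
    change star (A.1 ^ (i : ℕ) *ᵥ v) ⬝ᵥ (A.1 ^ (j : ℕ) *ᵥ v) = _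
    rw [Matrix.one_apply]
    split_ifs with hij
    · rw [hij]
      exact (star_mulVec_dotProduct_mulVec (A ^ (j : ℕ)) v v).trans hv
    · have h := star_mulVec_dotProduct_mulVec B (A.1 ^ (i : ℕ) *ᵥ v) (A.1 ^ (j : ℕ) *ᵥ v)
      rw [hBA_v, hBA_v, star_smul, smul_dotProduct, dotProduct_smul, smul_smul, smul_eq_mul] at h
      by_contra hne
      have h1 : star (omega d ^ (i : ℕ)) * omega d ^ (j : ℕ) = 1 :=
        mul_right_cancel₀ hne (by rw [h, one_mul])
      have h2 : omega d ^ (i : ℕ) * star (omega d ^ (i : ℕ)) = 1 := by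
        rw [Complex.star_def, Complex.mul_conj, Complex.normSq_eq_norm_sq, norm_pow, norm_omega]
        simp
      have h3 : omega d ^ (j : ℕ) = omega d ^ (i : ℕ) := by
        calc omega d ^ (j : ℕ)
            = omega d ^ (i : ℕ) * star (omega d ^ (i : ℕ)) * omega d ^ (j : ℕ) := by
              rw [h2, one_mul]
          _ = omega d ^ (i : ℕ) := by rw [mul_assoc, h1, mul_one]
      exact hij (Fin.ext (hω.pow_inj j.2 i.2 h3).symm)
  · ext i r
    rw [mul_Smat_apply hd]
    change (A.1 ^ (((r : ℕ) + 1) % d) *ᵥ v) i = (A.1 *ᵥ (A.1 ^ (r : ℕ) *ᵥ v)) i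
    rw [← pow_eq_pow_mod _ hA', pow_succ', Matrix.mulVec_mulVec]
  · ext i r
    rw [Tmat, Matrix.mul_diagonal]
    change _ = (B.1 *ᵥ (A.1 ^ (r : ℕ) *ᵥ v)) i
    rw [hBA_v, Pi.smul_apply, smul_eq_mul, mul_comm, Matrix.of_apply]

theorem unitaryGroup_coe_zpow {n : Type*} [Fintype n] [DecidableEq n]
    (A : Matrix.unitaryGroup n ℂ) (k : ℤ) : (A ^ k).1 = A.1 ^ k := by
  have hinv (B : Matrix.unitaryGroup n ℂ) : (B⁻¹).1 = B.1⁻¹ :=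
    (Matrix.inv_eq_left_inv (Matrix.mem_unitaryGroup_iff'.mp B.2)).symm
  cases k with
  | ofNat k => simp
  | negSucc k => rw [zpow_negSucc, zpow_negSucc, hinv, SubmonoidClass.coe_pow]

theorem smul_one_zpow {n : Type*} [Fintype n] [DecidableEq n] {z : ℂ} (hz : z ≠ 0) (k : ℤ) :
    (z • (1 : Matrix n n ℂ)) ^ k = z ^ k • 1 := by
  cases k with
  | ofNat k => simp [smul_pow]
  | negSucc k =>
    rw [zpow_negSucc, zpow_negSucc, smul_pow, one_pow]
    refine Matrix.inv_eq_left_inv ?_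
    rw [smul_mul_smul_comm, one_mul, inv_mul_cancel₀ (pow_ne_zero _ hz), one_smul]

/-- The scalar matrix `τ`, as a unitary. -/
def tauUnitary (d : ℕ) : Matrix.unitaryGroup (Fin d) ℂ :=
  ⟨tau d • 1, smul_one_mem_unitaryGroup (norm_tau d)⟩

theorem tau_ne_zero (d : ℕ) : tau d ≠ 0 := by
  rw [← norm_ne_zero_iff, norm_tau]; exact one_ne_zero

theorem coe_tauUnitary_zpow (d : ℕ) (k : ℤ) : (tauUnitary d ^ k).1 = tau d ^ k • 1 := by
  rw [unitaryGroup_coe_zpow, tauUnitary, smul_one_zpow (tau_ne_zero d)]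

theorem tauUnitary_commute (d : ℕ) (g : Matrix.unitaryGroup (Fin d) ℂ) :
    Commute (tauUnitary d) g :=
  Subtype.ext (by simp [tauUnitary])

theorem tauUnitary_zpow_eq_one {d : ℕ} (hd : d ≠ 0) {k : ℤ} (hk : (dbar d : ℤ) ∣ k) :
    tauUnitary d ^ k = 1 := by
  obtain ⟨m, rfl⟩ := hk
  apply Subtype.ext
  rw [coe_tauUnitary_zpow, _root_.zpow_mul, zpow_natCast, tau_pow_dbar hd, _root_.one_zpow, one_smul]
  rfl

/-- The shift `S`, as a unitary. -/
def shiftUnitary {d : ℕ} (hd : d ≠ 0) : Matrix.unitaryGroup (Fin d) ℂ :=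
  ⟨Smat d, Smat_mem_unitaryGroup hd⟩

/-- The clock matrix `T`, as a unitary. -/
def clockUnitary (d : ℕ) : Matrix.unitaryGroup (Fin d) ℂ := ⟨Tmat d, Tmat_mem_unitaryGroup d⟩

theorem coe_heis {d : ℕ} (hd : d ≠ 0) (p : ℤ × ℤ) :
    (heis (tauUnitary d) (shiftUnitary hd) (clockUnitary d) p).1 = Dmat d p := by
  rw [heis, Submonoid.coe_mul, Submonoid.coe_mul, coe_tauUnitary_zpow, unitaryGroup_coe_zpow,
    unitaryGroup_coe_zpow, smul_one_mul]
  rfl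

theorem omega_zpow (d : ℕ) (k : ℤ) : omega d ^ k = tau d ^ (2 * k) := by
  rw [_root_.zpow_mul, ← tau_sq]; norm_cast

theorem clockUnitary_mul_shiftUnitary {d : ℕ} (hd : d ≠ 0) :
    clockUnitary d * shiftUnitary hd
      = tauUnitary d ^ (2 : ℤ) * shiftUnitary hd * clockUnitary d := by
  apply Subtype.ext
  rw [Submonoid.coe_mul, Submonoid.coe_mul, Submonoid.coe_mul, coe_tauUnitary_zpow, smul_one_mul,
    smul_mul_assoc, zpow_ofNat, tau_sq]
  exact Tmat_mul_Smat hd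

theorem shiftUnitary_pow_self {d : ℕ} (hd : d ≠ 0) : shiftUnitary hd ^ d = 1 :=
  Subtype.ext (Smat_pow_self hd)

theorem clockUnitary_pow_self {d : ℕ} (hd : d ≠ 0) : clockUnitary d ^ d = 1 :=
  Subtype.ext (Tmat_pow_self hd)

/-- A displacement operator changes only by a phase when its index is scaled by `k ≡ 1 (mod d)`. -/
theorem Dmat_smul {d : ℕ} (hd : d ≠ 0) {k : ℤ} (hk : (d : ℤ) ∣ k - 1) (p : ℤ × ℤ) :
    Dmat d (k • p) = tau d ^ ((k * k - 1) * (p.1 * p.2)) • Dmat d p := by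
  obtain ⟨m, hm⟩ := hk
  have hpow {g : Matrix.unitaryGroup (Fin d) ℂ} (hg : g ^ d = 1) (a : ℤ) : g ^ (k * a) = g ^ a := by
    rw [show k * a = d * (m * a) + a by rw [← mul_assoc, ← hm]; ring, _root_.zpow_add, _root_.zpow_mul,
      zpow_natCast, hg, _root_.one_zpow, one_mul]
  rw [← coe_heis hd, ← coe_heis hd,
    ← smul_one_mul (tau d ^ _) (heis (tauUnitary d) (shiftUnitary hd) (clockUnitary d) p).1, ← coe_tauUnitary_zpow, ← Submonoid.coe_mul]
  congr 1
  simp only [heis, Prod.smul_fst, Prod.smul_snd, smul_eq_mul, hpow (shiftUnitary_pow_self hd),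
    hpow (clockUnitary_pow_self hd)]
  rw [← mul_assoc (tauUnitary d ^ ((k * k - 1) * _)), ← _root_.zpow_add]
  congr 2
  ring

theorem smul_Dmat_mem_Wset {d : ℕ} {z : ℂ} (hz : ‖z‖ = 1) (p : ℤ × ℤ) : z • Dmat d p ∈ Wset d := by
  obtain ⟨ξ, rfl⟩ := (Complex.norm_eq_one_iff z).mp hz
  exact ⟨ξ, p, rfl⟩

theorem image_conj_Wset {d : ℕ} (hd : d ≠ 0) {F : Matrix (Fin 2) (Fin 2) ℤ}
    (hdet : (d : ℤ) ∣ F.det - 1) {χ : ℤ × ℤ} {U : Matrix (Fin d) (Fin d) ℂ}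
    (hU : ∀ p : ℤ × ℤ,
      U * Dmat d p * Uᴴ = omega d ^ symp χ (Fapp F p) • Dmat d (Fapp F p)) :
    (fun M => U * M * Uᴴ) '' Wset d = Wset d := by
  have hconj (z : ℂ) (p : ℤ × ℤ) : U * (z • Dmat d p) * Uᴴ
      = (z * omega d ^ symp χ (Fapp F p)) • Dmat d (Fapp F p) := by
    rw [Matrix.mul_smul, Matrix.smul_mul, hU, smul_smul]
  apply Set.Subset.antisymm
  · rintro _ ⟨_, ⟨ξ, p, rfl⟩, rfl⟩
    simp only [hconj]
    exact smul_Dmat_mem_Wset (by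
      rw [norm_mul, Complex.norm_exp_ofReal_mul_I, norm_zpow, norm_omega, _root_.one_zpow, one_mul]) _
  · rintro _ ⟨ξ, q, rfl⟩
    have hp : Fapp F (F 1 1 * q.1 - F 0 1 * q.2, F 0 0 * q.2 - F 1 0 * q.1) = F.det • q := by
      ext <;> simp [Fapp, Matrix.det_fin_two] <;> ring
    generalize (F 1 1 * q.1 - F 0 1 * q.2, F 0 0 * q.2 - F 1 0 * q.1) = p at hp
    have hω : omega d ^ symp χ (F.det • q) ≠ 0 :=
      zpow_ne_zero _ (norm_ne_zero_iff.mp (by rw [norm_omega]; exact one_ne_zero))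
    have hτ : tau d ^ ((F.det * F.det - 1) * (q.1 * q.2)) ≠ 0 := zpow_ne_zero _ (tau_ne_zero d)
    refine ⟨(Complex.exp (ξ * Complex.I) * (omega d ^ symp χ (F.det • q))⁻¹
      * (tau d ^ ((F.det * F.det - 1) * (q.1 * q.2)))⁻¹) • Dmat d p,
      smul_Dmat_mem_Wset ?_ p, ?_⟩
    · simp [Complex.norm_exp_ofReal_mul_I, norm_omega, norm_tau]
    · simp only [hconj, hp, Dmat_smul hd hdet, smul_smul]
      congr 1
      field_simp

/-- For every integer matrix `F` with `det F ≡ 1 (mod d̄)` and every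
`χ ∈ ℤ²` there is a unitary `U` (necessarily in the Clifford group, i.e. normalizing
`W(d)`) with `U D_p U† = ω^{⟨χ,Fp⟩} D_{Fp}` for all `p ∈ ℤ²`. -/
theorem stmt3 (d : ℕ) (hd : 2 ≤ d) (F : Matrix (Fin 2) (Fin 2) ℤ)
    (hdet : F.det ≡ 1 [ZMOD (dbar d)]) (χ : ℤ × ℤ) :
    ∃ U : Matrix (Fin d) (Fin d) ℂ,
      U ∈ Matrix.unitaryGroup (Fin d) ℂ ∧
      (fun M => U * M * Uᴴ) '' Wset d = Wset d ∧
      ∀ p : ℤ × ℤ,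
        U * Dmat d p * Uᴴ =
          omega d ^ symp χ (Fapp F p) • Dmat d (Fapp F p) := by
  have hd0 : d ≠ 0 := by omega
  have hdvd : (dbar d : ℤ) ∣ F.det - 1 := hdet.symm.dvd
  set c := tauUnitary d
  set s := shiftUnitary hd0
  set t := clockUnitary d
  have hc : ∀ g, Commute c g := tauUnitary_commute d
  have hts : t * s = c ^ (2 : ℤ) * s * t := clockUnitary_mul_shiftUnitary hd0
  have hs : s ^ d = 1 := shiftUnitary_pow_self hd0
  have ht : t ^ d = 1 := clockUnitary_pow_self hd0
  have hcd : c ^ (d * d) = 1 := by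
    rw [← zpow_natCast]
    exact tauUnitary_zpow_eq_one hd0 (Int.natCast_dvd_natCast.mpr (dbar_dvd_mul_self d))
  have hphase (k : ℤ) (p : ℤ × ℤ) : (c ^ (2 * k) * heis c s t p) ^ d = 1 := by
    rw [← zpow_natCast, ((hc _).zpow_left _).mul_zpow, heis_zpow_natCast_eq_one hc hts hs ht hcd,
      mul_one, ← _root_.zpow_mul]
    refine tauUnitary_zpow_eq_one hd0 ?_
    rw [mul_right_comm]
    exact Dvd.dvd.mul_right (by exact_mod_cast dbar_dvd_two_mul d) _
  obtain ⟨A, hA⟩ : ∃ A,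
      A = c ^ (2 * symp χ (F 0 0, F 1 0)) * heis c s t (F 0 0, F 1 0) :=
    ⟨_, rfl⟩
  obtain ⟨B, hB⟩ : ∃ B,
      B = c ^ (2 * symp χ (F 0 1, F 1 1)) * heis c s t (F 0 1, F 1 1) :=
    ⟨_, rfl⟩
  have hBA : B * A = c ^ (2 : ℤ) * (A * B) := by
    have hmul (i j : ℤ) (p q : ℤ × ℤ) : c ^ i * heis c s t p * (c ^ j * heis c s t q)
        = c ^ (i + j + symp p q) * heis c s t (p + q) := by
      rw [mul_assoc, ← mul_assoc (heis c s t p), ← ((hc (heis c s t p)).zpow_left j).eq,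
        mul_assoc, heis_mul hc hts, _root_.zpow_add, _root_.zpow_add]
      simp only [mul_assoc]
    have hone : c ^ (2 * (F.det - 1)) = 1 := tauUnitary_zpow_eq_one hd0 (hdvd.mul_left 2)
    rw [hA, hB, hmul, hmul, ← mul_assoc, ← _root_.zpow_add, add_comm (F 0 1, F 1 1)]
    congr 1
    rw [← mul_one (c ^ (2 + _)), ← hone, ← _root_.zpow_add]
    congr 1
    simp [symp, Matrix.det_fin_two]; ring
  have hBA' : B.1 * A.1 = omega d • (A.1 * B.1) := by
    have h := congrArg Subtype.val hBA
    rw [Submonoid.coe_mul, Submonoid.coe_mul, Submonoid.coe_mul, coe_tauUnitary_zpow,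
      smul_one_mul, zpow_ofNat, tau_sq] at h
    exact h
  obtain ⟨U, hU, hUS, hUT⟩ := exists_intertwiner hd0 A B (hA ▸ hphase _ _) (hB ▸ hphase _ _) hBA'
  have hUs : (⟨U, hU⟩ : Matrix.unitaryGroup (Fin d) ℂ) * s * ⟨U, hU⟩⁻¹ = A := by
    rw [mul_inv_eq_iff_eq_mul]; exact Subtype.ext hUS
  have hUt : (⟨U, hU⟩ : Matrix.unitaryGroup (Fin d) ℂ) * t * ⟨U, hU⟩⁻¹ = B := by
    rw [mul_inv_eq_iff_eq_mul]; exact Subtype.ext hUT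
  have hconj (p : ℤ × ℤ) :
      U * Dmat d p * Uᴴ = omega d ^ symp χ (Fapp F p) • Dmat d (Fapp F p) := by
    have h := congrArg Subtype.val
      (conj_heis hc hts (tauUnitary_zpow_eq_one hd0 hdvd) (hUs.trans hA) (hUt.trans hB) p)
    rw [Submonoid.coe_mul, Submonoid.coe_mul, Submonoid.coe_mul, coe_tauUnitary_zpow, coe_heis,
      coe_heis, smul_one_mul, ← omega_zpow] at h
    exact h
  exact ⟨U, hU, image_conj_Wset hd0 ((Int.natCast_dvd_natCast.mpr (dvd_dbar d)).trans hdvd) hconj,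
    hconj⟩
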